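/- Theorem 2 (lower bound, explicit form). For every user-to-cache association g, the average delay satisfies T̄(g) ≥ (K_p/Λ) · (Λ−t)/(1+t). In particular, this lower bound is independent of the association g, so the optimal average delay over all associations is at least (K_p/Λ)·(Λ−t)/(1+t). -/

import Mathlib

open Finset

noncomputable section

/-- Probability weight of an activity pattern `ω` under independent Bernoulli
activities with success probabilities `p`. -/
def wgt {K : ℕ} (p : Fin K → ℝ) (ω : Fin K → Bool) : ℝ :=
  ∏ k, if ω k then p k else 1 - p k

/-- Load of cache `c` under association `g` and activity pattern `ω`:
the number of active users assigned to cache `c`. -/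
def load {K Λ : ℕ} (g : Fin K → Fin Λ) (ω : Fin K → Bool) (c : Fin Λ) : ℕ :=
  ∑ k, if g k = c ∧ ω k = true then 1 else 0

/-- Decreasing rearrangement of a tuple of naturals, indexed by `ℕ`
(value `0` out of range): `sortDescN v 0` is the largest entry,
`sortDescN v (Λ-1)` the smallest. -/
def sortDescN {Λ : ℕ} (v : Fin Λ → ℕ) (i : ℕ) : ℕ :=
  if h : i < Λ then (v ∘ Tuple.sort v) (Fin.rev ⟨i, h⟩) else 0

/-- Expectation of a real-valued functional of the activity pattern. -/
def expec {K : ℕ} (p : Fin K → ℝ) (f : (Fin K → Bool) → ℝ) : ℝ :=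
  ∑ ω : Fin K → Bool, wgt p ω * f ω

/-- Average worst-case delay of association `g`:
`T̄(g) = ∑_{λ=1}^{Λ-t} E[l_λ] C(Λ-λ,t)/C(Λ,t)` (here `i = λ - 1` is 0-based). -/
def avgDelay {K Λ : ℕ} (p : Fin K → ℝ) (g : Fin K → Fin Λ) (t : ℕ) : ℝ :=
  ∑ i ∈ Finset.range (Λ - t),
    expec p (fun ω => (sortDescN (load g ω) i : ℝ)) * ((Λ - 1 - i).choose t : ℝ) /
      (Λ.choose t : ℝ)

/-- `μ_λ`: expected number of active users assigned to cache `c`. -/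
def muC {K Λ : ℕ} (p : Fin K → ℝ) (g : Fin K → Fin Λ) (c : Fin Λ) : ℝ :=
  ∑ k, if g k = c then p k else 0

/-- `σ_λ²`: variance of the number of active users assigned to cache `c`. -/
def sigma2C {K Λ : ℕ} (p : Fin K → ℝ) (g : Fin K → Fin Λ) (c : Fin Λ) : ℝ :=
  ∑ k, if g k = c then p k * (1 - p k) else 0

/-- `|G_λ|`: the number of users assigned to cache `c`. -/
def Gcard {K Λ : ℕ} (g : Fin K → Fin Λ) (c : Fin Λ) : ℕ :=
  (Finset.univ.filter fun k => g k = c).card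

/-- Binomial cumulative distribution function `F_bin(n,q,x)`. -/
def Fbin (n : ℕ) (q : ℝ) (x : ℕ) : ℝ :=
  ∑ i ∈ Finset.range (x + 1), (n.choose i : ℝ) * q ^ i * (1 - q) ^ (n - i)

theorem sum_range_choose_eq_choose_succ (n t : ℕ) :
    ∑ m ∈ range n, m.choose t = n.choose (t + 1) := by
  induction n with
  | zero => simp
  | succ n ih => rw [sum_range_succ, ih, Nat.choose_succ_succ, add_comm]

theorem sum_range_sortDescN_mul_choose {Λ t : ℕ} (v : Fin Λ → ℕ) :
    ∑ i ∈ range (Λ - t), (sortDescN v i : ℝ) * ((Λ - 1 - i).choose t : ℝ) =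
      ∑ j : Fin Λ, ((v ∘ Tuple.sort v) j : ℝ) * ((j : ℕ).choose t : ℝ) := by
  have hext : ∑ i ∈ range (Λ - t), (sortDescN v i : ℝ) * ((Λ - 1 - i).choose t : ℝ) =
      ∑ i ∈ range Λ, (sortDescN v i : ℝ) * ((Λ - 1 - i).choose t : ℝ) := by
    refine sum_subset (range_mono (Nat.sub_le _ _)) fun i hi hi' => ?_
    rw [mem_range] at hi hi'
    rw [Nat.choose_eq_zero_of_lt (by lia), Nat.cast_zero, mul_zero]
  rw [hext, ← Fin.sum_univ_eq_sum_range
    (fun i => (sortDescN v i : ℝ) * ((Λ - 1 - i).choose t : ℝ)), ← Equiv.sum_comp Fin.revPerm]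
  refine sum_congr rfl fun j _ => ?_
  have hj : Λ - 1 - (Fin.rev j : ℕ) = j := by
    rw [Fin.val_rev]
    lia
  rw [Fin.revPerm_apply, hj, sortDescN, dif_pos (Fin.rev j).isLt, Fin.eta, Fin.rev_rev]

/-- Chebyshev's sum inequality for the decreasing rearrangement with binomial weights. -/
theorem sum_mul_choose_le_sum_sortDescN {Λ : ℕ} (t : ℕ) (v : Fin Λ → ℕ) :
    (∑ c, (v c : ℝ)) * (Λ.choose (t + 1) : ℝ) ≤
      Λ * ∑ i ∈ range (Λ - t), (sortDescN v i : ℝ) * ((Λ - 1 - i).choose t : ℝ) := by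
  have hmono : Monovary (fun j : Fin Λ => ((v ∘ Tuple.sort v) j : ℝ))
      (fun j : Fin Λ => ((j : ℕ).choose t : ℝ)) := by
    refine Monotone.monovary (fun a b hab => ?_) fun a b hab => ?_
    · exact_mod_cast Tuple.monotone_sort v hab
    · exact_mod_cast Nat.choose_le_choose t hab
  have hsum : ∑ j, ((v ∘ Tuple.sort v) j : ℝ) = ∑ c, (v c : ℝ) :=
    Equiv.sum_comp (Tuple.sort v) fun c => (v c : ℝ)
  have hchoose : ∑ j : Fin Λ, ((j : ℕ).choose t : ℝ) = (Λ.choose (t + 1) : ℝ) := by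
    rw [Fin.sum_univ_eq_sum_range (fun m => (m.choose t : ℝ))]
    exact_mod_cast sum_range_choose_eq_choose_succ Λ t
  have h := hmono.sum_mul_sum_le_card_mul_sum
  rwa [hsum, hchoose, Fintype.card_fin, ← sum_range_sortDescN_mul_choose] at h

theorem wgt_nonneg {K : ℕ} {p : Fin K → ℝ} (hp : ∀ k, 0 ≤ p k ∧ p k ≤ 1)
    (ω : Fin K → Bool) : 0 ≤ wgt p ω := by
  refine prod_nonneg fun k _ => ?_
  split_ifs
  · exact (hp k).1
  · linarith [(hp k).2]

theorem expec_active {K : ℕ} (p : Fin K → ℝ) (k : Fin K) :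
    expec p (fun ω => if ω k then 1 else 0) = p k := by
  have hprod (ω : Fin K → Bool) : wgt p ω * (if ω k then 1 else 0) =
      ∏ j, if ω j then p j else if j = k then 0 else 1 - p j := by
    cases hk : ω k
    · rw [prod_eq_zero (mem_univ k) (by simp [hk])]
      simp
    · rw [wgt, if_pos rfl, mul_one]
      refine prod_congr rfl fun j _ => ?_
      by_cases hj : j = k
      · simp [hj, hk]
      · simp [hj]
  simp_rw [expec, hprod]
  rw [← Fintype.prod_sum fun j (b : Bool) => if b then p j else if j = k then 0 else 1 - p j,
    Fintype.prod_eq_single k fun j hj => by simp [hj]]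
  simp

theorem sum_load {K Λ : ℕ} (g : Fin K → Fin Λ) (ω : Fin K → Bool) :
    ∑ c, (load g ω c : ℝ) = ∑ k, if ω k then (1 : ℝ) else 0 := by
  simp only [load, Nat.cast_sum]
  rw [sum_comm]
  refine sum_congr rfl fun k _ => ?_
  cases ω k <;> simp

theorem expec_sum_load {K Λ : ℕ} (p : Fin K → ℝ) (g : Fin K → Fin Λ) :
    expec p (fun ω => ∑ c, (load g ω c : ℝ)) = ∑ k, p k := by
  simp_rw [← expec_active p, expec, sum_load, mul_sum]
  exact sum_comm

theorem expec_mono {K : ℕ} {p : Fin K → ℝ} (hp : ∀ k, 0 ≤ p k ∧ p k ≤ 1)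
    {f h : (Fin K → Bool) → ℝ} (hfh : ∀ ω, f ω ≤ h ω) : expec p f ≤ expec p h :=
  sum_le_sum fun ω _ => mul_le_mul_of_nonneg_left (hfh ω) (wgt_nonneg hp ω)

theorem avgDelay_eq_expec {K Λ : ℕ} (p : Fin K → ℝ) (g : Fin K → Fin Λ) (t : ℕ) :
    avgDelay p g t = expec p (fun ω => ∑ i ∈ range (Λ - t),
      (sortDescN (load g ω) i : ℝ) * ((Λ - 1 - i).choose t : ℝ)) / (Λ.choose t : ℝ) := by
  simp only [avgDelay, expec, mul_sum, sum_mul, sum_div]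
  rw [sum_comm]
  simp only [mul_assoc]

/-- Theorem 2 (lower bound, explicit form): the average delay of every association `g`
is at least `(K_p/Λ)·(Λ-t)/(1+t)`; in particular the optimal average delay is at
least this quantity. -/
theorem theorem2_lower_bound {K Λ t : ℕ} (hΛ : 2 ≤ Λ) (ht1 : 1 ≤ t) (ht2 : t ≤ Λ - 1)
    (p : Fin K → ℝ) (hp : ∀ k, 0 ≤ p k ∧ p k ≤ 1) :
    ∀ g : Fin K → Fin Λ,
      ((∑ k, p k) / (Λ : ℝ)) * ((Λ : ℝ) - t) / (1 + t) ≤ avgDelay p g t := by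
  intro g
  have hΛ0 : (0 : ℝ) < Λ := by
    exact_mod_cast (by lia : 0 < Λ)
  have hC : (0 : ℝ) < Λ.choose t := by
    exact_mod_cast Nat.choose_pos (by lia : t ≤ Λ)
  have hrec : (Λ.choose (t + 1) : ℝ) * (t + 1) = Λ.choose t * (Λ - t) := by
    rw [← Nat.cast_sub (by lia : t ≤ Λ)]
    exact_mod_cast Nat.choose_succ_right_eq Λ t
  have hE := expec_mono hp fun ω => sum_mul_choose_le_sum_sortDescN t (load g ω)
  have hl : expec p (fun ω => (∑ c, (load g ω c : ℝ)) * (Λ.choose (t + 1) : ℝ)) =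
      (∑ k, p k) * (Λ.choose (t + 1) : ℝ) := by
    rw [← expec_sum_load p g]
    simp only [expec, ← mul_assoc, ← sum_mul]
  have hr (f : (Fin K → Bool) → ℝ) :
      expec p (fun ω => (Λ : ℝ) * f ω) = Λ * expec p f := by
    simp only [expec, mul_sum, mul_left_comm]
  rw [hl, hr] at hE
  have hbound : (∑ k, p k) / (Λ : ℝ) * ((Λ : ℝ) - t) / (1 + t) =
      (∑ k, p k) * (Λ.choose (t + 1) : ℝ) / (Λ * Λ.choose t) := by
    have : (1 + t : ℝ) ≠ 0 := by positivity
    field_simp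
    linear_combination -(∑ k, p k) * hrec
  rw [avgDelay_eq_expec, hbound, div_le_div_iff₀ (by positivity) hC]
  nlinarith [mul_le_mul_of_nonneg_right hE hC.le]

end
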